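/- arXiv:1311.0355 — 3 statements merged into one kernel-verified Lean document; each statement's English description precedes it below -/
import Mathlib

section
/- Suppose w : [0,∞) × [0,1] × [0,1] × ℝ × ℝ → ℝ is jointly measurable, continuous in its first, fourth, and fifth arguments, Lipschitz with constant L in each of its last two arguments, and satisfies |w(t,α,β,a,b)| ≤ W for some finite W. Then for any Lebesgue measurable function x̃_0 : [0,1] → [0,1] there exists a unique function x : [0,∞) × [0,1] → ℝ, written x_t(α), with the following four properties: (1) for every t ≥ 0 and every α ∈ [0,1], (d/dt) x_t(α) = ∫_0^1 w(t,α,β,x_t(α),x_t(β)) · (x_t(β) − x_t(α)) dβ; (2) x_0(α) = x̃_0(α) for all α ∈ [0,1]; (3) x_t(α) is Lebesgue measurable in α for each fixed t and continuously differentiable in t for each fixed α; (4) sup{|x_t(α)| : α ∈ [0,1], 0 ≤ t ≤ T} < ∞ for every T ≥ 0. -/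
open MeasureTheory Filter Set Topology

/-- The interaction field at time `t` for agent `α`:
`∫_0^1 w(t,α,β,x_t(α),x_t(β)) · (x_t(β) − x_t(α)) dβ`. -/
noncomputable def interactionField (w : ℝ → ℝ → ℝ → ℝ → ℝ → ℝ) (x : ℝ → ℝ → ℝ)
    (t α : ℝ) : ℝ :=
  ∫ β in (0:ℝ)..1, w t α β (x t α) (x t β) * (x t β - x t α)

/-- `f` is absolutely continuous on the compact interval `[a,b]`. -/
def AbsolutelyContinuousOn (f : ℝ → ℝ) (a b : ℝ) : Prop :=
  ∀ ε > 0, ∃ δ > 0, ∀ n : ℕ, ∀ c d : Fin n → ℝ,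
    (∀ i, a ≤ c i ∧ c i ≤ d i ∧ d i ≤ b) →
    (Pairwise fun i j => Set.Ioo (c i) (d i) ∩ Set.Ioo (c j) (d j) = ∅) →
    (∑ i, (d i - c i)) < δ → (∑ i, |f (d i) - f (c i)|) < ε

/-- `w` is an admissible weight function: jointly Borel measurable, nonnegative and
bounded by `W` on the domain `[0,∞) × [0,1] × [0,1] × ℝ × ℝ`. -/
structure IsWeight (W : ℝ) (w : ℝ → ℝ → ℝ → ℝ → ℝ → ℝ) : Prop where
  measurable : Measurable fun p : ℝ × ℝ × ℝ × ℝ × ℝ =>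
    w p.1 p.2.1 p.2.2.1 p.2.2.2.1 p.2.2.2.2
  nonneg : ∀ t, 0 ≤ t → ∀ α ∈ Icc (0:ℝ) 1, ∀ β ∈ Icc (0:ℝ) 1, ∀ a b : ℝ,
    0 ≤ w t α β a b
  le_bound : ∀ t, 0 ≤ t → ∀ α ∈ Icc (0:ℝ) 1, ∀ β ∈ Icc (0:ℝ) 1, ∀ a b : ℝ,
    w t α β a b ≤ W

/-- `x` is a solution of the opinion dynamics with weight function `w`:
measurable in the agent, absolutely continuous in time on compact intervals,
with initial opinions in `[0,1]`, locally bounded, and for each agent satisfying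
the ODE `(d/dt) x_t(α) = ∫_0^1 w(t,α,β,x_t(α),x_t(β))·(x_t(β) − x_t(α)) dβ`
for almost every `t ≥ 0`. -/
structure IsSolution (w : ℝ → ℝ → ℝ → ℝ → ℝ → ℝ) (x : ℝ → ℝ → ℝ) : Prop where
  meas : ∀ t, 0 ≤ t → Measurable (x t)
  absCont : ∀ α ∈ Icc (0:ℝ) 1, ∀ T, 0 ≤ T → AbsolutelyContinuousOn (fun t => x t α) 0 T
  init_mem : ∀ α ∈ Icc (0:ℝ) 1, x 0 α ∈ Icc (0:ℝ) 1
  locBdd : ∀ T, 0 ≤ T → ∃ M : ℝ, ∀ α ∈ Icc (0:ℝ) 1, ∀ t ∈ Icc (0:ℝ) T, |x t α| ≤ M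
  ode : ∀ α ∈ Icc (0:ℝ) 1, ∀ᵐ t ∂(volume.restrict (Ici (0:ℝ))),
    HasDerivAt (fun s => x s α) (interactionField w x t α) t

/-- The weight function is symmetric. -/
def SymmetricWeight (w : ℝ → ℝ → ℝ → ℝ → ℝ → ℝ) : Prop :=
  ∀ t α β a b, w t α β a b = w t β α b a

/-- `w ∈ Γ(r,Δ)`: the weight is at least `Δ` whenever the two opinions are within `r`. -/
def InGamma (r Δ : ℝ) (w : ℝ → ℝ → ℝ → ℝ → ℝ → ℝ) : Prop :=
  ∀ t, 0 ≤ t → ∀ α ∈ Icc (0:ℝ) 1, ∀ β ∈ Icc (0:ℝ) 1, ∀ a b : ℝ,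
    |a - b| ≤ r → Δ ≤ w t α β a b

/-- The opinion distribution `μ_t`: pushforward of Lebesgue measure on `[0,1]` by `x_t`. -/
noncomputable def opinionMeasure (x : ℝ → ℝ → ℝ) (t : ℝ) : Measure ℝ :=
  (volume.restrict (Icc (0:ℝ) 1)).map (x t)

/-- The order of the opinions is preserved: if agent `β`'s opinion is strictly above
agent `α`'s at some time, it is strictly above at every time. -/
def OrderPreserved (x : ℝ → ℝ → ℝ) : Prop :=
  ∀ α ∈ Icc (0:ℝ) 1, ∀ β ∈ Icc (0:ℝ) 1, ∀ s, 0 ≤ s → ∀ t, 0 ≤ t →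
    x t α < x t β → x s α < x s β

/-- The four properties required of a solution in the existence-uniqueness theorem:
(1) the ODE holds for every `t ≥ 0` and `α ∈ [0,1]` (derivative within `[0,∞)`);
(2) the initial condition is `x₀`;
(3) measurability in the agent and continuous differentiability in time (the ODE holds
    with a derivative that is continuous in `t`);
(4) no explosion in finite time. -/
def IsClassicalSolution (w : ℝ → ℝ → ℝ → ℝ → ℝ → ℝ) (x₀ : ℝ → ℝ)
    (x : ℝ → ℝ → ℝ) : Prop :=
  (∀ α ∈ Icc (0:ℝ) 1, ∀ t, 0 ≤ t →
    HasDerivWithinAt (fun s => x s α) (interactionField w x t α) (Ici (0:ℝ)) t) ∧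
  (∀ α ∈ Icc (0:ℝ) 1, x 0 α = x₀ α) ∧
  (∀ t, 0 ≤ t → Measurable (x t)) ∧
  (∀ α ∈ Icc (0:ℝ) 1, ContinuousOn (fun t => interactionField w x t α) (Ici (0:ℝ))) ∧
  (∀ T, 0 ≤ T → ∃ M : ℝ, ∀ α ∈ Icc (0:ℝ) 1, ∀ t ∈ Icc (0:ℝ) T, |x t α| ≤ M)

/-- Bounded, jointly measurable weights, continuous in time and Lipschitz in both opinions. -/
structure IsLipschitzWeight (W L : ℝ) (w : ℝ → ℝ → ℝ → ℝ → ℝ → ℝ) : Prop where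
  measurable : Measurable fun p : ℝ × ℝ × ℝ × ℝ × ℝ =>
    w p.1 p.2.1 p.2.2.1 p.2.2.2.1 p.2.2.2.2
  continuous_time : ∀ α β a b : ℝ, Continuous fun t => w t α β a b
  lipschitz_left : ∀ t α β a a' b : ℝ, |w t α β a b - w t α β a' b| ≤ L * |a - a'|
  lipschitz_right : ∀ t α β a b b' : ℝ, |w t α β a b - w t α β a b'| ≤ L * |b - b'|
  abs_le : ∀ t α β a b : ℝ, |w t α β a b| ≤ W

/-- A jointly measurable opinion profile that grows in time at rate at most `2 * W`. -/
structure IsOpinionProfile (W : ℝ) (x : ℝ → ℝ → ℝ) : Prop where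
  measurable : Measurable fun p : ℝ × ℝ => x p.1 p.2
  abs_le : ∀ t α, |x t α| ≤ Real.exp (2 * W * max t 0)

/-- The integral operator whose fixed points are the solutions with initial condition `x₀`. -/
noncomputable def picardMap (w : ℝ → ℝ → ℝ → ℝ → ℝ → ℝ) (x₀ : ℝ → ℝ) (x : ℝ → ℝ → ℝ)
    (t α : ℝ) : ℝ :=
  x₀ α + ∫ s in (0:ℝ)..max t 0, interactionField w x s α

/-- The Picard iterates started from the profile that is constant in time. -/
noncomputable def picardIterate (w : ℝ → ℝ → ℝ → ℝ → ℝ → ℝ) (x₀ : ℝ → ℝ) :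
    ℕ → ℝ → ℝ → ℝ
  | 0 => fun _ => x₀
  | n + 1 => picardMap w x₀ (picardIterate w x₀ n)

theorem integral_mul_exp (k t : ℝ) :
    ∫ s in (0:ℝ)..t, k * Real.exp (k * s) = Real.exp (k * t) - 1 := by
  have h : ∀ s ∈ uIcc 0 t, HasDerivAt (fun s => Real.exp (k * s)) (k * Real.exp (k * s)) s := by
    intro s _
    have := ((hasDerivAt_id s).const_mul k).exp
    simpa [mul_comm] using this
  rw [intervalIntegral.integral_eq_sub_of_hasDerivAt h
    (Continuous.intervalIntegrable (by fun_prop) _ _)]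
  simp

namespace IsLipschitzWeight

variable {W L : ℝ} {w : ℝ → ℝ → ℝ → ℝ → ℝ → ℝ}

theorem bound_nonneg (hw : IsLipschitzWeight W L w) : 0 ≤ W :=
  (abs_nonneg _).trans (hw.abs_le 0 0 0 0 0)

theorem lipschitz_nonneg (hw : IsLipschitzWeight W L w) : 0 ≤ L := by
  have := (abs_nonneg _).trans (hw.lipschitz_left 0 0 0 1 0 0)
  simpa using this

theorem abs_integrand_le (hw : IsLipschitzWeight W L w) {t α β a b M : ℝ}
    (ha : |a| ≤ M) (hb : |b| ≤ M) : |w t α β a b * (b - a)| ≤ 2 * W * M := by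
  have h1 : |b - a| ≤ 2 * M := by linarith [abs_sub b a]
  rw [abs_mul]
  calc _ ≤ W * (2 * M) :=
        mul_le_mul (hw.abs_le t α β a b) h1 (abs_nonneg _) hw.bound_nonneg
    _ = _ := by ring

theorem abs_integrand_sub_le (hw : IsLipschitzWeight W L w) {t α β a b a' b' M δ : ℝ}
    (ha : |a| ≤ M) (hb : |b| ≤ M) (haa : |a - a'| ≤ δ) (hbb : |b - b'| ≤ δ) :
    |w t α β a b * (b - a) - w t α β a' b' * (b' - a')| ≤ (4 * L * M + 2 * W) * δ := by
  have hL := hw.lipschitz_nonneg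
  have hδ : 0 ≤ δ := (abs_nonneg _).trans haa
  have h1 : |b - a| ≤ 2 * M := by linarith [abs_sub b a]
  have h2 : |w t α β a b - w t α β a' b'| ≤ 2 * L * δ := by
    have e1 := hw.lipschitz_left t α β a a' b
    have e2 := hw.lipschitz_right t α β a' b b'
    have e3 := abs_sub_le (w t α β a b) (w t α β a' b) (w t α β a' b')
    have e4 := mul_le_mul_of_nonneg_left haa hL
    have e5 := mul_le_mul_of_nonneg_left hbb hL
    linarith
  have h3 : |(b - b') - (a - a')| ≤ 2 * δ := by linarith [abs_sub (b - b') (a - a')]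
  have h4 : w t α β a b * (b - a) - w t α β a' b' * (b' - a')
      = (w t α β a b - w t α β a' b') * (b - a) + w t α β a' b' * ((b - b') - (a - a')) := by
    ring
  rw [h4]
  refine (abs_add_le _ _).trans ?_
  rw [abs_mul, abs_mul]
  have h5 := mul_le_mul h2 h1 (abs_nonneg _) (by positivity)
  have h6 := mul_le_mul (hw.abs_le t α β a' b') h3 (abs_nonneg _) hw.bound_nonneg
  linarith

theorem abs_interactionField_le (hw : IsLipschitzWeight W L w) {x : ℝ → ℝ → ℝ} {t α M : ℝ}
    (hα : |x t α| ≤ M) (hx : ∀ β ∈ Icc (0:ℝ) 1, |x t β| ≤ M) :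
    |interactionField w x t α| ≤ 2 * W * M := by
  have := intervalIntegral.norm_integral_le_of_norm_le_const (a := (0:ℝ)) (b := 1)
    (C := 2 * W * M) (f := fun β => w t α β (x t α) (x t β) * (x t β - x t α)) (by
      intro β hβ
      rw [uIoc_of_le zero_le_one] at hβ
      exact hw.abs_integrand_le hα (hx β ⟨hβ.1.le, hβ.2⟩))
  simpa [interactionField] using this

theorem measurable_integrand (hw : IsLipschitzWeight W L w) {x : ℝ → ℝ → ℝ} {t : ℝ}
    (hx : Measurable (x t)) (α : ℝ) :
    Measurable fun β => w t α β (x t α) (x t β) * (x t β - x t α) := by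
  have h : Measurable fun β => ((t, α, β, x t α, x t β) : ℝ × ℝ × ℝ × ℝ × ℝ) := by fun_prop
  exact (hw.measurable.comp h).mul (by fun_prop)

theorem intervalIntegrable_integrand (hw : IsLipschitzWeight W L w) {x : ℝ → ℝ → ℝ}
    {t α M : ℝ} (hm : Measurable (x t)) (hα : |x t α| ≤ M)
    (hx : ∀ β ∈ Icc (0:ℝ) 1, |x t β| ≤ M) :
    IntervalIntegrable (fun β => w t α β (x t α) (x t β) * (x t β - x t α)) volume 0 1 := by
  refine (intervalIntegrable_const (c := 2 * W * M)).mono_fun'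
    (hw.measurable_integrand hm α).aestronglyMeasurable ?_
  refine (ae_restrict_iff' measurableSet_uIoc).2 (Eventually.of_forall fun β hβ => ?_)
  rw [uIoc_of_le zero_le_one] at hβ
  exact hw.abs_integrand_le hα (hx β ⟨hβ.1.le, hβ.2⟩)

theorem abs_interactionField_sub_le (hw : IsLipschitzWeight W L w) {A : Set ℝ}
    (hA : Icc (0:ℝ) 1 ⊆ A) {x y : ℝ → ℝ → ℝ} {t M δ : ℝ}
    (hxm : Measurable (x t)) (hym : Measurable (y t))
    (hx : ∀ α ∈ A, |x t α| ≤ M) (hy : ∀ α ∈ A, |y t α| ≤ M)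
    (hxy : ∀ α ∈ A, |x t α - y t α| ≤ δ) {α : ℝ} (hα : α ∈ A) :
    |interactionField w x t α - interactionField w y t α| ≤ (4 * L * M + 2 * W) * δ := by
  unfold interactionField
  rw [← intervalIntegral.integral_sub
    (hw.intervalIntegrable_integrand hxm (hx α hα) fun β hβ => hx β (hA hβ))
    (hw.intervalIntegrable_integrand hym (hy α hα) fun β hβ => hy β (hA hβ))]
  have := intervalIntegral.norm_integral_le_of_norm_le_const (a := (0:ℝ)) (b := 1)
    (C := (4 * L * M + 2 * W) * δ)
    (f := fun β => w t α β (x t α) (x t β) * (x t β - x t α)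
      - w t α β (y t α) (y t β) * (y t β - y t α)) (by
      intro β hβ
      rw [uIoc_of_le zero_le_one] at hβ
      have hβ' := hA ⟨hβ.1.le, hβ.2⟩
      exact hw.abs_integrand_sub_le (hx α hα) (hx β hβ') (hxy α hα) (hxy β hβ'))
  simpa using this

/-- The integrated interaction field halves distances in an exponentially weighted norm. -/
theorem abs_integral_interactionField_sub_le (hw : IsLipschitzWeight W L w) {A : Set ℝ}
    (hA : Icc (0:ℝ) 1 ⊆ A) {x y : ℝ → ℝ → ℝ} {T M D : ℝ}
    (hxm : ∀ t ∈ Icc 0 T, Measurable (x t)) (hym : ∀ t ∈ Icc 0 T, Measurable (y t))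
    (hx : ∀ t ∈ Icc 0 T, ∀ α ∈ A, |x t α| ≤ M) (hy : ∀ t ∈ Icc 0 T, ∀ α ∈ A, |y t α| ≤ M)
    (hxy : ∀ t ∈ Icc 0 T, ∀ α ∈ A,
      |x t α - y t α| ≤ D * Real.exp (2 * (4 * L * M + 2 * W) * t))
    {t : ℝ} (ht : t ∈ Icc 0 T) {α : ℝ} (hα : α ∈ A)
    (hxi : IntervalIntegrable (fun s => interactionField w x s α) volume 0 t)
    (hyi : IntervalIntegrable (fun s => interactionField w y s α) volume 0 t) :
    |(∫ s in (0:ℝ)..t, interactionField w x s α) - ∫ s in (0:ℝ)..t, interactionField w y s α|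
      ≤ D / 2 * Real.exp (2 * (4 * L * M + 2 * W) * t) := by
  set K := 4 * L * M + 2 * W with hK
  have hD : 0 ≤ D := by
    have := (abs_nonneg _).trans (hxy t ht α hα)
    exact nonneg_of_mul_nonneg_left this (Real.exp_pos _)
  rw [← intervalIntegral.integral_sub hxi hyi]
  have h := intervalIntegral.norm_integral_le_of_norm_le (μ := volume) ht.1
    (f := fun s => interactionField w x s α - interactionField w y s α)
    (g := fun s => D / 2 * (2 * K * Real.exp (2 * K * s)))
    (Eventually.of_forall fun s hs => by
      have hs' : s ∈ Icc 0 T := ⟨hs.1.le, hs.2.trans ht.2⟩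
      have := hw.abs_interactionField_sub_le hA (hxm s hs') (hym s hs') (hx s hs') (hy s hs')
        (hxy s hs') hα
      rw [Real.norm_eq_abs]
      calc _ ≤ _ := this
        _ = _ := by rw [← hK]; ring)
    (Continuous.intervalIntegrable (by fun_prop) _ _)
  rw [intervalIntegral.integral_const_mul, integral_mul_exp] at h
  refine h.trans ?_
  have : 0 ≤ D / 2 := by positivity
  nlinarith

theorem measurable_interactionField (hw : IsLipschitzWeight W L w) {x : ℝ → ℝ → ℝ}
    (hx : Measurable fun p : ℝ × ℝ => x p.1 p.2) :
    Measurable fun p : ℝ × ℝ => interactionField w x p.1 p.2 := by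
  have h1 : Measurable fun q : (ℝ × ℝ) × ℝ => x q.1.1 q.1.2 :=
    hx.comp (measurable_fst : Measurable fun q : (ℝ × ℝ) × ℝ => q.1)
  have h2 : Measurable fun q : (ℝ × ℝ) × ℝ => x q.1.1 q.2 :=
    hx.comp (by fun_prop : Measurable fun q : (ℝ × ℝ) × ℝ => (q.1.1, q.2))
  have h3 : Measurable fun q : (ℝ × ℝ) × ℝ =>
      ((q.1.1, q.1.2, q.2, x q.1.1 q.1.2, x q.1.1 q.2) : ℝ × ℝ × ℝ × ℝ × ℝ) := by fun_prop
  have h4 := (hw.measurable.comp h3).mul (h2.sub h1)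
  have := h4.stronglyMeasurable.integral_prod_right' (ν := volume.restrict (Ioc (0:ℝ) 1))
  simp only [interactionField, intervalIntegral.integral_of_le zero_le_one]
  exact this.measurable

theorem abs_interactionField_le_exp (hw : IsLipschitzWeight W L w) {x : ℝ → ℝ → ℝ}
    (hx : IsOpinionProfile W x) (t α : ℝ) :
    |interactionField w x t α| ≤ 2 * W * Real.exp (2 * W * max t 0) :=
  hw.abs_interactionField_le (hx.abs_le t α) fun β _ => hx.abs_le t β

theorem intervalIntegrable_interactionField (hw : IsLipschitzWeight W L w) {x : ℝ → ℝ → ℝ}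
    (hx : IsOpinionProfile W x) (α a b : ℝ) :
    IntervalIntegrable (fun s => interactionField w x s α) volume a b := by
  have hg : Continuous fun s : ℝ => 2 * W * Real.exp (2 * W * max s 0) := by fun_prop
  refine (hg.intervalIntegrable a b).mono_fun' ?_
    (Eventually.of_forall fun s => hw.abs_interactionField_le_exp hx s α)
  exact ((hw.measurable_interactionField hx.measurable).comp
    measurable_prodMk_right).aestronglyMeasurable

theorem continuous_picardMap (hw : IsLipschitzWeight W L w) {x : ℝ → ℝ → ℝ}
    (hx : IsOpinionProfile W x) (x₀ : ℝ → ℝ) (α : ℝ) :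
    Continuous fun t => picardMap w x₀ x t α := by
  have h := intervalIntegral.continuous_primitive
    (hw.intervalIntegrable_interactionField hx α) 0
  exact continuous_const.add (h.comp (by fun_prop : Continuous fun t : ℝ => max t 0))

theorem isOpinionProfile_picardMap (hw : IsLipschitzWeight W L w) {x : ℝ → ℝ → ℝ}
    (hx : IsOpinionProfile W x) {x₀ : ℝ → ℝ} (hm : Measurable x₀) (h0 : ∀ α, |x₀ α| ≤ 1) :
    IsOpinionProfile W (picardMap w x₀ x) where
  measurable := by
    have hF := hw.measurable_interactionField hx.measurable
    have hmeas : ∀ t, Measurable fun α => picardMap w x₀ x t α := by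
      intro t
      simp only [picardMap, intervalIntegral.integral_of_le (le_max_right t 0)]
      have := hF.stronglyMeasurable.integral_prod_left'
        (μ := volume.restrict (Ioc (0:ℝ) (max t 0)))
      exact hm.add this.measurable
    have := measurable_uncurry_of_continuous_of_measurable
      (u := fun (t α : ℝ) => picardMap w x₀ x t α) (hw.continuous_picardMap hx x₀) hmeas
    exact this
  abs_le t α := by
    have h := intervalIntegral.norm_integral_le_of_norm_le (μ := volume) (le_max_right t 0)
      (f := fun s => interactionField w x s α)
      (g := fun s => 2 * W * Real.exp (2 * W * s))
      (Eventually.of_forall fun s hs => by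
        have := hw.abs_interactionField_le_exp hx s α
        rwa [max_eq_left hs.1.le] at this)
      (Continuous.intervalIntegrable (by fun_prop) _ _)
    rw [integral_mul_exp, Real.norm_eq_abs] at h
    have := abs_add_le (x₀ α) (∫ s in (0:ℝ)..max t 0, interactionField w x s α)
    unfold picardMap
    linarith [h0 α]

theorem isOpinionProfile_picardIterate (hw : IsLipschitzWeight W L w) {x₀ : ℝ → ℝ}
    (hm : Measurable x₀) (h0 : ∀ α, |x₀ α| ≤ 1) (n : ℕ) :
    IsOpinionProfile W (picardIterate w x₀ n) := by
  induction n with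
  | zero =>
    refine ⟨hm.comp measurable_snd, fun t α => (h0 α).trans (Real.one_le_exp ?_)⟩
    have := hw.bound_nonneg
    positivity
  | succ n ih => exact hw.isOpinionProfile_picardMap ih hm h0

theorem abs_le_exp_of_mem_Icc (hw : IsLipschitzWeight W L w) {x : ℝ → ℝ → ℝ}
    (hx : IsOpinionProfile W x) {t T : ℝ} (ht : t ∈ Icc 0 T) (α : ℝ) :
    |x t α| ≤ Real.exp (2 * W * T) := by
  refine (hx.abs_le t α).trans (Real.exp_le_exp.2 ?_)
  rw [max_eq_left ht.1]
  exact mul_le_mul_of_nonneg_left ht.2 (by linarith [hw.bound_nonneg])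

theorem abs_picardMap_sub_le (hw : IsLipschitzWeight W L w) {x y : ℝ → ℝ → ℝ}
    (hx : IsOpinionProfile W x) (hy : IsOpinionProfile W y) (x₀ : ℝ → ℝ) {T D : ℝ}
    (hxy : ∀ t ∈ Icc 0 T, ∀ α, |x t α - y t α| ≤
      D * Real.exp (2 * (4 * L * Real.exp (2 * W * T) + 2 * W) * t))
    {t : ℝ} (ht : t ∈ Icc 0 T) (α : ℝ) :
    |picardMap w x₀ x t α - picardMap w x₀ y t α| ≤
      D / 2 * Real.exp (2 * (4 * L * Real.exp (2 * W * T) + 2 * W) * t) := by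
  have h := hw.abs_integral_interactionField_sub_le (subset_univ _) (x := x) (y := y) (T := T)
    (M := Real.exp (2 * W * T)) (D := D)
    (fun s _ => hx.measurable.comp measurable_prodMk_left)
    (fun s _ => hy.measurable.comp measurable_prodMk_left)
    (fun s hs γ _ => hw.abs_le_exp_of_mem_Icc hx hs γ)
    (fun s hs γ _ => hw.abs_le_exp_of_mem_Icc hy hs γ)
    (fun s hs γ _ => hxy s hs γ) ht (mem_univ α)
    (hw.intervalIntegrable_interactionField hx α 0 t)
    (hw.intervalIntegrable_interactionField hy α 0 t)
  simpa only [picardMap, max_eq_left ht.1, add_sub_add_left_eq_sub] using h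

theorem dist_picardIterate_succ_le (hw : IsLipschitzWeight W L w) {x₀ : ℝ → ℝ}
    (hm : Measurable x₀) (h0 : ∀ α, |x₀ α| ≤ 1) {T : ℝ} (n : ℕ) :
    ∀ t ∈ Icc 0 T, ∀ α, |picardIterate w x₀ n t α - picardIterate w x₀ (n + 1) t α| ≤
      2 * Real.exp (2 * W * T) / 2 ^ n *
        Real.exp (2 * (4 * L * Real.exp (2 * W * T) + 2 * W) * t) := by
  induction n with
  | zero =>
    intro t ht α
    have h1 := hw.abs_le_exp_of_mem_Icc (hw.isOpinionProfile_picardIterate hm h0 0) ht α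
    have h2 := hw.abs_le_exp_of_mem_Icc (hw.isOpinionProfile_picardIterate hm h0 1) ht α
    have h3 := abs_sub (picardIterate w x₀ 0 t α) (picardIterate w x₀ 1 t α)
    have hW := hw.bound_nonneg
    have hL := hw.lipschitz_nonneg
    have ht0 := ht.1
    have h4 : 1 ≤ Real.exp (2 * (4 * L * Real.exp (2 * W * T) + 2 * W) * t) :=
      Real.one_le_exp (by positivity)
    have h5 := Real.exp_pos (2 * W * T)
    simp only [pow_zero, div_one, zero_add]
    nlinarith
  | succ n ih =>
    intro t ht α
    have h := hw.abs_picardMap_sub_le (hw.isOpinionProfile_picardIterate hm h0 n)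
      (hw.isOpinionProfile_picardIterate hm h0 (n + 1)) x₀ ih ht α
    rwa [div_div, ← pow_succ] at h

theorem exists_picardMap_eq (hw : IsLipschitzWeight W L w) {x₀ : ℝ → ℝ}
    (hm : Measurable x₀) (h0 : ∀ α, |x₀ α| ≤ 1) :
    ∃ x, IsOpinionProfile W x ∧ ∀ t, 0 ≤ t → ∀ α, picardMap w x₀ x t α = x t α := by
  have hP := hw.isOpinionProfile_picardIterate hm h0
  have hgeom : ∀ {T t : ℝ}, t ∈ Icc 0 T → ∀ α n,
      dist (picardIterate w x₀ n t α) (picardIterate w x₀ (n + 1) t α) ≤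
        4 * Real.exp (2 * W * T) *
          Real.exp (2 * (4 * L * Real.exp (2 * W * T) + 2 * W) * t) / 2 / 2 ^ n := by
    intro T t ht α n
    rw [Real.dist_eq]
    refine (hw.dist_picardIterate_succ_le hm h0 n t ht α).trans (le_of_eq ?_)
    ring
  have hlim : ∀ t α, ∃ l, Tendsto (fun n => picardIterate w x₀ n (max t 0) α) atTop (𝓝 l) :=
    fun t α => cauchySeq_tendsto_of_complete (cauchySeq_of_le_geometric_two
      (hgeom ⟨le_max_right t 0, le_rfl⟩ α))
  choose x hx using hlim
  have hxP : IsOpinionProfile W x := by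
    constructor
    · refine measurable_of_tendsto_metrizable (f := fun n (p : ℝ × ℝ) =>
        picardIterate w x₀ n (max p.1 0) p.2) (fun n => ?_)
        (tendsto_pi_nhds.2 fun p => hx p.1 p.2)
      exact (hP n).measurable.comp
        (by fun_prop : Measurable fun p : ℝ × ℝ => (max p.1 0, p.2))
    · intro t α
      refine le_of_tendsto (hx t α).abs (Eventually.of_forall fun n => ?_)
      simpa using (hP n).abs_le (max t 0) α
  refine ⟨x, hxP, fun T hT α => ?_⟩
  have hxT : ∀ t, 0 ≤ t → ∀ γ, Tendsto (fun n => picardIterate w x₀ n t γ) atTop (𝓝 (x t γ)) :=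
    fun t ht γ => by simpa only [max_eq_left ht] using hx t γ
  have hdist : ∀ n, ∀ t ∈ Icc 0 T, ∀ γ, |picardIterate w x₀ n t γ - x t γ| ≤
      4 * Real.exp (2 * W * T) / 2 ^ n *
        Real.exp (2 * (4 * L * Real.exp (2 * W * T) + 2 * W) * t) := by
    intro n t ht γ
    rw [← Real.dist_eq]
    refine (dist_le_of_le_geometric_two_of_tendsto (hgeom ht γ) (hxT t ht.1 γ) n).trans
      (le_of_eq ?_)
    ring
  have hTT : T ∈ Icc 0 T := ⟨hT, le_rfl⟩
  have hmap : Tendsto (fun n => picardIterate w x₀ (n + 1) T α) atTop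
      (𝓝 (picardMap w x₀ x T α)) := by
    rw [tendsto_iff_dist_tendsto_zero]
    refine squeeze_zero (fun _ => dist_nonneg)
      (fun n => hw.abs_picardMap_sub_le (hP n) hxP x₀ (hdist n) hTT α) ?_
    have := tendsto_pow_atTop_nhds_zero_of_lt_one (r := (1:ℝ) / 2) (by norm_num) (by norm_num)
    have := this.const_mul (4 * Real.exp (2 * W * T) / 2 *
      Real.exp (2 * (4 * L * Real.exp (2 * W * T) + 2 * W) * T))
    rw [mul_zero] at this
    refine this.congr fun n => ?_
    rw [one_div, inv_pow]
    ring
  exact tendsto_nhds_unique hmap ((tendsto_add_atTop_iff_nat 1).2 (hxT T hT α))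

theorem continuous_weight_comp (hw : IsLipschitzWeight W L w) (α β : ℝ) {a b : ℝ → ℝ}
    (ha : Continuous a) (hb : Continuous b) : Continuous fun t => w t α β (a t) (b t) := by
  rw [continuous_iff_continuousAt]
  intro t
  have h1 := (hw.continuous_time α β (a t) (b t)).tendsto t
  have h2 : Tendsto (fun s => L * |a s - a t| + L * |b s - b t|) (𝓝 t) (𝓝 0) := by
    have : Continuous fun s => L * |a s - a t| + L * |b s - b t| := by fun_prop
    simpa using this.tendsto t
  have h3 : Tendsto (fun s => w s α β (a s) (b s) - w s α β (a t) (b t)) (𝓝 t) (𝓝 0) := by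
    refine squeeze_zero_norm (fun s => ?_) h2
    have e1 := hw.lipschitz_left s α β (a s) (a t) (b s)
    have e2 := hw.lipschitz_right s α β (a t) (b s) (b t)
    have e3 := abs_sub_le (w s α β (a s) (b s)) (w s α β (a t) (b s)) (w s α β (a t) (b t))
    rw [Real.norm_eq_abs]
    linarith
  simpa [ContinuousAt] using h3.add h1

theorem continuous_interactionField (hw : IsLipschitzWeight W L w) {x : ℝ → ℝ → ℝ}
    (hx : IsOpinionProfile W x) (hc : ∀ α, Continuous fun t => x t α) (α : ℝ) :
    Continuous fun t => interactionField w x t α := by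
  rw [continuous_iff_continuousAt]
  intro t
  have hg : Continuous fun s : ℝ => 2 * W * Real.exp (2 * W * max s 0) := by fun_prop
  refine intervalIntegral.continuousAt_of_dominated_interval
    (bound := fun _ => 2 * W * Real.exp (2 * W * max t 0) + 1) ?_ ?_
    intervalIntegrable_const ?_
  · exact Eventually.of_forall fun s => (hw.measurable_integrand
      (hx.measurable.comp measurable_prodMk_left) α).aestronglyMeasurable
  · filter_upwards [hg.continuousAt.eventually_lt continuousAt_const (lt_add_one _)] with s hs
    exact Eventually.of_forall fun β _ =>
      (hw.abs_integrand_le (hx.abs_le s α) (hx.abs_le s β)).trans hs.le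
  · exact Eventually.of_forall fun β _ =>
      ((hw.continuous_weight_comp α β (hc α) (hc β)).mul ((hc β).sub (hc α))).continuousAt

theorem exists_isClassicalSolution (hw : IsLipschitzWeight W L w) {x₀ : ℝ → ℝ}
    (hm : Measurable x₀) (h0 : ∀ α, |x₀ α| ≤ 1) : ∃ x, IsClassicalSolution w x₀ x := by
  obtain ⟨z, hz, hfix⟩ := hw.exists_picardMap_eq hm h0
  set x := picardMap w x₀ z with hxdef
  have hx : IsOpinionProfile W x := hw.isOpinionProfile_picardMap hz hm h0
  have hF : ∀ t, 0 ≤ t → ∀ α, interactionField w z t α = interactionField w x t α := by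
    intro t ht α
    simp only [interactionField, hfix t ht]
  have hcF := hw.continuous_interactionField hx (hw.continuous_picardMap hz x₀)
  have heq : ∀ t, 0 ≤ t → ∀ α,
      x t α = x₀ α + ∫ s in (0:ℝ)..t, interactionField w x s α := by
    intro t ht α
    rw [hxdef, picardMap, max_eq_left ht, ← hxdef]
    congr 1
    refine intervalIntegral.integral_congr fun s hs => hF s ?_ α
    rw [uIcc_of_le ht] at hs
    exact hs.1
  refine ⟨x, fun α _ t ht => ?_, fun α _ => ?_, fun t _ => ?_, fun α _ => ?_, fun T _ => ?_⟩
  · have h := intervalIntegral.integral_hasDerivAt_right ((hcF α).intervalIntegrable 0 t)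
      (hcF α).aestronglyMeasurable.stronglyMeasurableAtFilter (hcF α).continuousAt
    exact ((h.const_add (x₀ α)).hasDerivWithinAt).congr (fun s hs => heq s hs α) (heq t ht α)
  · simpa using heq 0 le_rfl α
  · exact hx.measurable.comp measurable_prodMk_left
  · exact (hcF α).continuousOn
  · exact ⟨_, fun α _ t ht => hw.abs_le_exp_of_mem_Icc hx ht α⟩

end IsLipschitzWeight

namespace IsClassicalSolution

variable {w : ℝ → ℝ → ℝ → ℝ → ℝ → ℝ} {x₀ : ℝ → ℝ} {x y : ℝ → ℝ → ℝ}

theorem congr_initial (hx : IsClassicalSolution w x₀ x) {x₁ : ℝ → ℝ}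
    (h : ∀ α ∈ Icc (0:ℝ) 1, x₀ α = x₁ α) : IsClassicalSolution w x₁ x :=
  ⟨hx.1, fun α hα => (hx.2.1 α hα).trans (h α hα), hx.2.2⟩

theorem intervalIntegrable (hx : IsClassicalSolution w x₀ x) {α : ℝ}
    (hα : α ∈ Icc (0:ℝ) 1) {t : ℝ} (ht : 0 ≤ t) :
    IntervalIntegrable (fun s => interactionField w x s α) volume 0 t := by
  refine ((hx.2.2.2.1 α hα).mono fun s hs => ?_).intervalIntegrable
  rw [uIcc_of_le ht] at hs
  exact hs.1

theorem eq_add_integral (hx : IsClassicalSolution w x₀ x) {α : ℝ} (hα : α ∈ Icc (0:ℝ) 1)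
    {t : ℝ} (ht : 0 ≤ t) :
    x t α = x₀ α + ∫ s in (0:ℝ)..t, interactionField w x s α := by
  have hd := hx.1 α hα
  rw [intervalIntegral.integral_eq_sub_of_hasDerivAt_of_le ht
    (f := fun s => x s α) ?_ ?_ (hx.intervalIntegrable hα ht), hx.2.1 α hα]
  · ring
  · exact fun s hs => (hd s hs.1).continuousWithinAt.mono fun r hr => hr.1
  · exact fun s hs => (hd s hs.1.le).hasDerivAt (Ici_mem_nhds hs.1)

theorem unique {W L : ℝ} (hw : IsLipschitzWeight W L w) (hx : IsClassicalSolution w x₀ x)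
    (hy : IsClassicalSolution w x₀ y) {T : ℝ} (hT : 0 ≤ T) {α : ℝ}
    (hα : α ∈ Icc (0:ℝ) 1) : x T α = y T α := by
  obtain ⟨M₁, h₁⟩ := hx.2.2.2.2 T hT
  obtain ⟨M₂, h₂⟩ := hy.2.2.2.2 T hT
  set M := max M₁ M₂
  have hxM : ∀ t ∈ Icc 0 T, ∀ γ ∈ Icc (0:ℝ) 1, |x t γ| ≤ M :=
    fun t ht γ hγ => (h₁ γ hγ t ht).trans (le_max_left _ _)
  have hyM : ∀ t ∈ Icc 0 T, ∀ γ ∈ Icc (0:ℝ) 1, |y t γ| ≤ M :=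
    fun t ht γ hγ => (h₂ γ hγ t ht).trans (le_max_right _ _)
  have hW := hw.bound_nonneg
  have hL := hw.lipschitz_nonneg
  have hTT : T ∈ Icc 0 T := ⟨hT, le_rfl⟩
  have hM : 0 ≤ M := (abs_nonneg _).trans (hxM T hTT α hα)
  have key : ∀ n : ℕ, ∀ t ∈ Icc 0 T, ∀ γ ∈ Icc (0:ℝ) 1, |x t γ - y t γ| ≤
      2 * M / 2 ^ n * Real.exp (2 * (4 * L * M + 2 * W) * t) := by
    intro n
    induction n with
    | zero =>
      intro t ht γ hγ
      have h3 := abs_sub (x t γ) (y t γ)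
      have h4 : 1 ≤ Real.exp (2 * (4 * L * M + 2 * W) * t) :=
        Real.one_le_exp (mul_nonneg (by positivity) ht.1)
      have := hxM t ht γ hγ
      have := hyM t ht γ hγ
      simp only [pow_zero, div_one]
      nlinarith
    | succ n ih =>
      intro t ht γ hγ
      have h := hw.abs_integral_interactionField_sub_le subset_rfl
        (fun s hs => hx.2.2.1 s hs.1) (fun s hs => hy.2.2.1 s hs.1) hxM hyM ih ht hγ
        (hx.intervalIntegrable hγ ht.1) (hy.intervalIntegrable hγ ht.1)
      rw [div_div, ← pow_succ] at h
      rwa [hx.eq_add_integral hγ ht.1, hy.eq_add_integral hγ ht.1, add_sub_add_left_eq_sub]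
  have hlim : Tendsto (fun n : ℕ => 2 * M / 2 ^ n * Real.exp (2 * (4 * L * M + 2 * W) * T))
      atTop (𝓝 0) := by
    have := tendsto_pow_atTop_nhds_zero_of_lt_one (r := (1:ℝ) / 2) (by norm_num) (by norm_num)
    have := this.const_mul (2 * M * Real.exp (2 * (4 * L * M + 2 * W) * T))
    rw [mul_zero] at this
    refine this.congr fun n => ?_
    rw [one_div, inv_pow]
    ring
  have h := ge_of_tendsto' hlim fun n => key n T hTT α hα
  exact sub_eq_zero.1 (abs_nonpos_iff.1 h)

end IsClassicalSolution

/-- Under joint measurability, continuity in the time and opinion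
arguments, Lipschitz continuity in the opinion arguments and uniform boundedness of the
weight function, for every measurable initial condition `x₀ : [0,1] → [0,1]` there is a
unique solution of the opinion dynamics satisfying properties (1)–(4). -/
theorem existence_and_uniqueness_of_solutions
    (W L : ℝ) (w : ℝ → ℝ → ℝ → ℝ → ℝ → ℝ)
    (hmeas : Measurable fun p : ℝ × ℝ × ℝ × ℝ × ℝ =>
      w p.1 p.2.1 p.2.2.1 p.2.2.2.1 p.2.2.2.2)
    (hcont1 : ∀ α β a b : ℝ, Continuous fun t => w t α β a b)
    (hcont4 : ∀ t α β b : ℝ, Continuous fun a => w t α β a b)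
    (hcont5 : ∀ t α β a : ℝ, Continuous fun b => w t α β a b)
    (hlip4 : ∀ t α β a a' b : ℝ, |w t α β a b - w t α β a' b| ≤ L * |a - a'|)
    (hlip5 : ∀ t α β a b b' : ℝ, |w t α β a b - w t α β a b'| ≤ L * |b - b'|)
    (hbdd : ∀ t α β a b : ℝ, |w t α β a b| ≤ W)
    (x₀ : ℝ → ℝ) (hx₀meas : Measurable x₀)
    (hx₀mem : ∀ α ∈ Icc (0:ℝ) 1, x₀ α ∈ Icc (0:ℝ) 1) :
    ∃ x : ℝ → ℝ → ℝ, IsClassicalSolution w x₀ x ∧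
      ∀ y : ℝ → ℝ → ℝ, IsClassicalSolution w x₀ y →
        ∀ t, 0 ≤ t → ∀ α ∈ Icc (0:ℝ) 1, y t α = x t α := by
  have hw : IsLipschitzWeight W L w := ⟨hmeas, hcont1, hlip4, hlip5, hbdd⟩
  have hind : ∀ α ∈ Icc (0:ℝ) 1, (Icc (0:ℝ) 1).indicator x₀ α = x₀ α :=
    fun α hα => indicator_of_mem hα x₀
  obtain ⟨x, hx⟩ := hw.exists_isClassicalSolution (hx₀meas.indicator measurableSet_Icc)
    (fun α => by
      by_cases hα : α ∈ Icc (0:ℝ) 1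
      · have := hx₀mem α hα
        rw [hind α hα, abs_of_nonneg this.1]
        exact this.2
      · simp [indicator_of_notMem hα])
  have hx' := hx.congr_initial hind
  exact ⟨x, hx', fun y hy t ht α hα => hy.unique hw hx' ht hα⟩
end

section
/- Let x : [0,∞) × [0,1] → ℝ be a function, written x_t(α), that is Lebesgue measurable in α for each fixed t, and suppose the order of x is preserved. Let A ⊆ [0,1] be a Lebesgue measurable set of positive Lebesgue measure. Then there exists γ ∈ A such that the set {β ∈ A : x_t(β) ≤ x_t(γ) for all t ≥ 0} has positive Lebesgue measure. -/
open MeasureTheory Filter Set Topology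

/-- A set of positive outer measure contains a point whose sublevel set, for a given real-valued
function, meets it in positive outer measure. -/
theorem exists_mem_measure_sublevel_pos {α : Type*} [MeasurableSpace α] (μ : Measure α)
    (f : α → ℝ) {A : Set α} (hA : 0 < μ A) :
    ∃ γ ∈ A, 0 < μ {β ∈ A | f β ≤ f γ} := by
  by_cases hmax : ∃ γ ∈ A, ∀ β ∈ A, f β ≤ f γ
  · obtain ⟨γ, hγ, hle⟩ := hmax
    exact ⟨γ, hγ, hA.trans_le (measure_mono fun β hβ => ⟨hβ, hle β hβ⟩)⟩
  · push Not at hmax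
    have hcover : A ⊆ ⋃ q : ℚ, {β ∈ A | f β < q ∧ ∃ γ ∈ A, (q : ℝ) < f γ} := fun β hβ => by
      obtain ⟨γ, hγ, hlt⟩ := hmax β hβ
      obtain ⟨q, hq, hq'⟩ := exists_rat_btwn hlt
      exact mem_iUnion.2 ⟨q, hβ, hq, γ, hγ, hq'⟩
    obtain ⟨q, hq⟩ := exists_measure_pos_of_not_measure_iUnion_null
      (hA.trans_le (measure_mono hcover)).ne'
    obtain ⟨-, -, -, γ, hγ, hqγ⟩ := nonempty_of_measure_ne_zero hq.ne'
    exact ⟨γ, hγ, hq.trans_le (measure_mono fun β hβ => ⟨hβ.1, (hβ.2.1.trans hqγ).le⟩)⟩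

/-- Let `x_t(α)` be measurable in `α` for each `t ≥ 0` and suppose the
order of `x` is preserved. Then every Lebesgue measurable `A ⊆ [0,1]` of positive
measure contains a `γ` such that the set of `β ∈ A` with `x_t(β) ≤ x_t(γ)` for all
`t ≥ 0` has positive measure. -/
theorem exists_agent_dominating_positive_measure_subset
    (x : ℝ → ℝ → ℝ)
    (hmeas : ∀ t, 0 ≤ t → Measurable (x t))
    (horder : OrderPreserved x)
    (A : Set ℝ) (hAsub : A ⊆ Icc (0:ℝ) 1)
    (hAmeas : NullMeasurableSet A volume) (hApos : 0 < volume A) :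
    ∃ γ ∈ A, 0 < volume {β ∈ A | ∀ t, 0 ≤ t → x t β ≤ x t γ} := by
  obtain ⟨γ, hγ, hpos⟩ := exists_mem_measure_sublevel_pos volume (x 0) hApos
  refine ⟨γ, hγ, hpos.trans_le (measure_mono fun β hβ => ⟨hβ.1, fun t ht => ?_⟩)⟩
  exact not_lt.1 fun hlt =>
    hβ.2.not_gt (horder γ (hAsub hγ) β (hAsub hβ.1) 0 le_rfl t ht hlt)
end

section
/- Let x : [0,∞) × [0,1] → [0,1] be a function, written x_t(α), that is Lebesgue measurable in α for each fixed t. Suppose the measures μ_t converge in distribution to some finite Borel measure μ_∞, and the order of x is preserved. Let N = {α ∈ [0,1] : lim_{t→∞} x_t(α) does not exist}, and for α ∈ N let I_α denote the nonempty open interval (liminf_{t→∞} x_t(α), limsup_{t→∞} x_t(α)). Then for every α ∈ N, the set N_α = {β ∈ N : I_β ∩ I_α ≠ ∅} has Lebesgue measure zero. -/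
open MeasureTheory Filter Set Topology

/-- The set of agents in `[0,1]` whose opinion does not converge as `t → ∞`. -/
def nonConvergentSet (x : ℝ → ℝ → ℝ) : Set ℝ :=
  {α ∈ Icc (0:ℝ) 1 | ¬ ∃ l : ℝ, Tendsto (fun t => x t α) atTop (𝓝 l)}

/-- The open interval `I_α = (liminf_{t→∞} x_t(α), limsup_{t→∞} x_t(α))`. -/
noncomputable def oscillationInterval (x : ℝ → ℝ → ℝ) (α : ℝ) : Set ℝ :=
  Ioo (Filter.liminf (fun t => x t α) atTop) (Filter.limsup (fun t => x t α) atTop)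

instance (x : ℝ → ℝ → ℝ) (t : ℝ) : IsFiniteMeasure (opinionMeasure x t) := by
  unfold opinionMeasure
  exact Measure.isFiniteMeasure_map _ _

namespace OrderPreserved

variable {x : ℝ → ℝ → ℝ}

theorem lt_iff_lt (h : OrderPreserved x) {α β s t : ℝ} (hα : α ∈ Icc (0 : ℝ) 1)
    (hβ : β ∈ Icc (0 : ℝ) 1) (hs : 0 ≤ s) (ht : 0 ≤ t) : x t α < x t β ↔ x s α < x s β :=
  ⟨h α hα β hβ s hs t ht, h α hα β hβ t ht s hs⟩

theorem opinionMeasure_Iio_eq (h : OrderPreserved x) (hmeas : ∀ t, 0 ≤ t → Measurable (x t))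
    {α s t : ℝ} (hα : α ∈ Icc (0 : ℝ) 1) (hs : 0 ≤ s) (ht : 0 ≤ t) :
    opinionMeasure x t (Iio (x t α)) = opinionMeasure x s (Iio (x s α)) := by
  unfold opinionMeasure
  rw [Measure.map_apply (hmeas t ht) measurableSet_Iio,
    Measure.map_apply (hmeas s hs) measurableSet_Iio,
    Measure.restrict_apply (hmeas t ht measurableSet_Iio),
    Measure.restrict_apply (hmeas s hs measurableSet_Iio)]
  congr 1
  ext β
  simp only [mem_inter_iff, mem_preimage, mem_Iio]
  exact and_congr_left fun hβ ↦ h.lt_iff_lt hβ hα hs ht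

theorem opinionMeasure_Iic_eq (h : OrderPreserved x) (hmeas : ∀ t, 0 ≤ t → Measurable (x t))
    {α s t : ℝ} (hα : α ∈ Icc (0 : ℝ) 1) (hs : 0 ≤ s) (ht : 0 ≤ t) :
    opinionMeasure x t (Iic (x t α)) = opinionMeasure x s (Iic (x s α)) := by
  unfold opinionMeasure
  rw [Measure.map_apply (hmeas t ht) measurableSet_Iic,
    Measure.map_apply (hmeas s hs) measurableSet_Iic,
    Measure.restrict_apply (hmeas t ht measurableSet_Iic),
    Measure.restrict_apply (hmeas s hs measurableSet_Iic)]
  congr 1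
  ext β
  simp only [mem_inter_iff, mem_preimage, mem_Iic]
  exact and_congr_left fun hβ ↦ le_iff_le_iff_lt_iff_lt.2 (h.lt_iff_lt hα hβ hs ht)

end OrderPreserved

/-- The levels at which both one-sided distribution functions of a finite measure take a given
value form a null set. -/
theorem measure_setOf_Iio_eq_and_Iic_eq (ν : Measure ℝ) [IsFiniteMeasure ν] (c : ENNReal) :
    ν {y | ν (Iio y) = c ∧ ν (Iic y) = c} = 0 := by
  have hS : MeasurableSet {y | ν (Iio y) = c ∧ ν (Iic y) = c} := by
    have h1 : Monotone fun y ↦ ν (Iio y) := fun a b h ↦ measure_mono (Iio_subset_Iio h)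
    have h2 : Monotone fun y ↦ ν (Iic y) := fun a b h ↦ measure_mono (Iic_subset_Iic.2 h)
    exact (h1.measurable (measurableSet_singleton c)).inter
      (h2.measurable (measurableSet_singleton c))
  rw [hS.measure_eq_iSup_isCompact]
  simp only [ENNReal.iSup_eq_zero]
  intro K hKS hK
  rcases K.eq_empty_or_nonempty with rfl | hne
  · exact measure_empty
  obtain ⟨a, ha⟩ := hK.exists_isLeast hne
  obtain ⟨b, hb⟩ := hK.exists_isGreatest hne
  refine measure_mono_null (t := Iic b \ Iio a)
    (fun y hy ↦ ⟨hb.2 hy, not_lt.2 (ha.2 hy)⟩) ?_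
  rw [measure_sdiff ((Iio_subset_Iio (ha.2 hb.1)).trans Iio_subset_Iic_self)
    measurableSet_Iio.nullMeasurableSet (measure_ne_top _ _),
    (hKS hb.1).2, (hKS ha.1).1, tsub_self]

theorem frequently_lt_and_frequently_gt_of_mem_oscillationInterval {x : ℝ → ℝ → ℝ}
    (hmem : ∀ t, 0 ≤ t → ∀ α ∈ Icc (0 : ℝ) 1, x t α ∈ Icc (0 : ℝ) 1) {α y : ℝ}
    (hα : α ∈ Icc (0 : ℝ) 1) (hy : y ∈ oscillationInterval x α) :
    (∃ᶠ t in atTop, x t α < y) ∧ ∃ᶠ t in atTop, y < x t α := by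
  have hle : IsBoundedUnder (· ≤ ·) atTop fun t ↦ x t α :=
    isBoundedUnder_of_eventually_le (a := 1)
      ((eventually_ge_atTop 0).mono fun t ht ↦ (hmem t ht α hα).2)
  have hge : IsBoundedUnder (· ≥ ·) atTop fun t ↦ x t α :=
    isBoundedUnder_of_eventually_ge (a := 0)
      ((eventually_ge_atTop 0).mono fun t ht ↦ (hmem t ht α hα).1)
  exact ⟨frequently_lt_of_liminf_lt hle.isCoboundedUnder_flip hy.1,
    frequently_lt_of_lt_limsup hge.isCoboundedUnder_flip hy.2⟩

/-- If the opinion of `α` is infinitely often below `y` and infinitely often above `z > y`, then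
the proportions of agents with opinion below, respectively at most, that of `α` agree with the
limit of the integrals of any function interpolating between `1` on `(-∞, y]` and `0` on
`[z, ∞)`. -/
theorem opinionMeasure_real_eq_of_tendsto_integral {x : ℝ → ℝ → ℝ}
    (hmeas : ∀ t, 0 ≤ t → Measurable (x t)) (horder : OrderPreserved x) {α y z l : ℝ}
    (hα : α ∈ Icc (0 : ℝ) 1) {η : BoundedContinuousFunction ℝ ℝ} (hηz : EqOn η 0 (Ici z))
    (hηy : EqOn η 1 (Iic y)) (hη : ∀ u, η u ∈ Icc (0 : ℝ) 1)
    (hl : Tendsto (fun t ↦ ∫ u, η u ∂(opinionMeasure x t)) atTop (𝓝 l))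
    (hlt : ∃ᶠ t in atTop, x t α < y) (hgt : ∃ᶠ t in atTop, z < x t α) :
    (opinionMeasure x 0).real (Iio (x 0 α)) = l ∧
      (opinionMeasure x 0).real (Iic (x 0 α)) = l := by
  have hle : (opinionMeasure x 0).real (Iic (x 0 α)) ≤ l := by
    refine ge_of_tendsto_of_frequently hl
      ((hlt.and_eventually (eventually_ge_atTop 0)).mono ?_)
    rintro t ⟨hty, ht⟩
    rw [measureReal_def, ← horder.opinionMeasure_Iic_eq hmeas hα le_rfl ht, ← measureReal_def,
      ← integral_indicator_one measurableSet_Iic]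
    refine integral_mono ((integrable_const 1).indicator measurableSet_Iic)
      (η.integrable _) fun u ↦ ?_
    refine indicator_le' (fun u hu ↦ ?_) (fun u _ ↦ (hη u).1) u
    exact (hηy (le_trans hu hty.le)).ge
  have hge : l ≤ (opinionMeasure x 0).real (Iio (x 0 α)) := by
    refine le_of_tendsto_of_frequently hl
      ((hgt.and_eventually (eventually_ge_atTop 0)).mono ?_)
    rintro t ⟨htz, ht⟩
    rw [measureReal_def, ← horder.opinionMeasure_Iio_eq hmeas hα le_rfl ht, ← measureReal_def,
      ← integral_indicator_one measurableSet_Iio]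
    refine integral_mono (η.integrable _)
      ((integrable_const 1).indicator measurableSet_Iio) fun u ↦ ?_
    refine le_indicator (fun u _ ↦ (hη u).2) (fun u hu ↦ ?_) u
    exact (hηz (htz.le.trans (not_lt.1 hu))).le
  have hmono : (opinionMeasure x 0).real (Iio (x 0 α)) ≤
      (opinionMeasure x 0).real (Iic (x 0 α)) := measureReal_mono Iio_subset_Iic_self
  exact ⟨by linarith, by linarith⟩

/-- Let `x_t(α) ∈ [0,1]` be measurable in `α` for each `t ≥ 0`,
suppose the opinion distributions converge in distribution and the order of `x` is
preserved. Then for every non-convergent agent `α`, the set of non-convergent agents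
`β` whose oscillation interval meets that of `α` is Lebesgue-null. -/
theorem oscillation_intervals_rarely_overlap
    (x : ℝ → ℝ → ℝ)
    (hmem : ∀ t, 0 ≤ t → ∀ α ∈ Icc (0:ℝ) 1, x t α ∈ Icc (0:ℝ) 1)
    (hmeas : ∀ t, 0 ≤ t → Measurable (x t))
    (μlim : Measure ℝ) (hfin : IsFiniteMeasure μlim)
    (hconv : ∀ η : BoundedContinuousFunction ℝ ℝ,
      Tendsto (fun t => ∫ y, η y ∂(opinionMeasure x t)) atTop
        (𝓝 (∫ y, η y ∂μlim)))
    (horder : OrderPreserved x) :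
    ∀ α ∈ nonConvergentSet x,
      volume {β ∈ nonConvergentSet x |
        (oscillationInterval x β ∩ oscillationInterval x α).Nonempty} = 0 := by
  intro α hα
  have hnull := measure_setOf_Iio_eq_and_Iic_eq (opinionMeasure x 0)
    (opinionMeasure x 0 (Iio (x 0 α)))
  set S := {y | opinionMeasure x 0 (Iio y) = opinionMeasure x 0 (Iio (x 0 α)) ∧
    opinionMeasure x 0 (Iic y) = opinionMeasure x 0 (Iio (x 0 α))}
  have hvol : volume (x 0 ⁻¹' S ∩ Icc (0 : ℝ) 1) = 0 := by
    rw [← Measure.restrict_apply' measurableSet_Icc]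
    exact Measure.preimage_null_of_map_null (hmeas 0 le_rfl).aemeasurable hnull
  refine measure_mono_null ?_ hvol
  rintro β ⟨hβ, hne⟩
  refine ⟨?_, hβ.1⟩
  obtain ⟨y, ⟨hyβ₁, hyβ₂⟩, hyα₁, hyα₂⟩ := hne
  obtain ⟨z, hyz, hz⟩ := exists_between (lt_min hyβ₂ hyα₂)
  have hyβ := frequently_lt_and_frequently_gt_of_mem_oscillationInterval hmem hβ.1
    ⟨hyβ₁, hyβ₂⟩
  have hyα := frequently_lt_and_frequently_gt_of_mem_oscillationInterval hmem hα.1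
    ⟨hyα₁, hyα₂⟩
  have hzβ := frequently_lt_and_frequently_gt_of_mem_oscillationInterval hmem hβ.1
    ⟨hyβ₁.trans hyz, hz.trans_le (min_le_left _ _)⟩
  have hzα := frequently_lt_and_frequently_gt_of_mem_oscillationInterval hmem hα.1
    ⟨hyα₁.trans hyz, hz.trans_le (min_le_right _ _)⟩
  obtain ⟨η, hηz, hηy, hη⟩ := exists_bounded_zero_one_of_closed
    (isClosed_Ici (a := z)) (isClosed_Iic (a := y))
    (Set.disjoint_left.2 fun u hu hu' ↦ (hyz.trans_le hu).not_ge hu')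
  have hrα := opinionMeasure_real_eq_of_tendsto_integral hmeas horder hα.1 hηz hηy hη
    (hconv η) hyα.1 hzα.2
  have hrβ := opinionMeasure_real_eq_of_tendsto_integral hmeas horder hβ.1 hηz hηy hη
    (hconv η) hyβ.1 hzβ.2
  exact ⟨(measureReal_eq_measureReal_iff).1 (hrβ.1.trans hrα.1.symm),
    (measureReal_eq_measureReal_iff).1 (hrβ.2.trans hrα.1.symm)⟩
end
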